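/- Let W be a d-dimensional fractional Brownian motion with Hurst parameter H ∈ (0,1) and continuous sample paths. There is a constant C_H depending only on H such that for every integer p ≥ 1, all 0 ≤ s < t ≤ 1, all ω ∈ ℝ and all ξ ∈ ℝ^d with ξ ≠ 0: E[ |∫_s^t exp(i⟨ξ, W_u⟩ + iωu) du|^{2p} ] ≤ ((2p)!/p!) · C_H^p · ((t−s) |ξ|^{−1/H})^p. -/

import Mathlib

open MeasureTheory Filter Topology
open scoped ENNReal NNReal

noncomputable section

abbrev Euc (d : ℕ) : Type := EuclideanSpace ℝ (Fin d)

/-- `Y^w_{s,t}(ω,ξ) = ∫_s^t exp(i ξ·w_u + i ω u) du`. -/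
def Yint {d : ℕ} (w : ℝ → Euc d) (s t ω : ℝ) (ξ : Euc d) : ℂ :=
  ∫ u in s..t, Complex.exp (Complex.I * Complex.ofReal (inner ℝ ξ (w u) + ω * u))

/-- The averaging constant `K^w_{α,γ}`. -/
def avgK {d : ℕ} (w : ℝ → Euc d) (α γ : ℝ) : ℝ≥0∞ :=
  ⨆ (s : ℝ) (t : ℝ) (_ : 0 ≤ s) (_ : s < t) (_ : t ≤ 1) (ω : ℝ) (ξ : Euc d),
    ENNReal.ofReal (‖Yint w s t ω ξ‖ /
      ((1 + ‖ξ‖) ^ α * (1 + Real.sqrt (Real.log (1 + |ω|))) * (t - s) ^ γ))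

/-- The norm `N_α` of a space-time vector field given through its Fourier transform `bhat`. -/
def FLnorm (d : ℕ) (α : ℝ) (bhat : ℝ × Euc d → Fin d → ℂ) : ℝ≥0∞ :=
  ∫⁻ p : ℝ × Euc d, ENNReal.ofReal (‖bhat p‖ * (1 + ‖p.2‖) ^ α *
    (1 + Real.sqrt (Real.log (1 + |p.1|))))

/-- The vector field `b(t,x)` recovered from its space-time Fourier transform. -/
def fieldOf {d : ℕ} (bhat : ℝ × Euc d → Fin d → ℂ) (t : ℝ) (x : Euc d) : Euc d :=
  (EuclideanSpace.equiv (Fin d) ℝ).symm fun i =>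
    ∫ p : ℝ × Euc d, (bhat p i * Complex.exp (Complex.I * Complex.ofReal (p.1 * t + inner ℝ p.2 x))).re

/-- The averaged vector field `σ^w_{[s,t]} b`, defined through the Fourier representation. -/
def sigmaAvg {d : ℕ} (w : ℝ → Euc d) (bhat : ℝ × Euc d → Fin d → ℂ) (s t : ℝ) (x : Euc d) :
    Euc d :=
  (EuclideanSpace.equiv (Fin d) ℝ).symm fun i =>
    ∫ p : ℝ × Euc d, (bhat p i * Yint w s t p.1 p.2 *
      Complex.exp (Complex.I * Complex.ofReal (inner ℝ p.2 x))).re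

/-- Partitions of the interval `[s,t]`. -/
structure IntervalPartition (s t : ℝ) where
  n : ℕ
  pts : ℕ → ℝ
  first : pts 0 = s
  last : pts n = t
  mono : ∀ i, i < n → pts i ≤ pts (i + 1)

/-- The mesh of the partition is smaller than `δ`. -/
def IntervalPartition.MeshLt {s t : ℝ} (P : IntervalPartition s t) (δ : ℝ) : Prop :=
  ∀ i, i < P.n → P.pts (i + 1) - P.pts i < δ

/-- Riemann sums `Σ_i (G_{t_{i+1}} - G_{t_i})(f_{t_i})` of the nonlinear Young integral. -/
def RiemannSum {V W : Type*} [AddCommGroup W] (G : ℝ → V → W) (f : ℝ → V)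
    {s t : ℝ} (P : IntervalPartition s t) : W :=
  ∑ i ∈ Finset.range P.n, (G (P.pts (i + 1)) (f (P.pts i)) - G (P.pts i) (f (P.pts i)))

/-- `L` is the nonlinear Young integral `∫_s^t G_{du}(f_u)`: the Riemann sums converge to `L`
as the mesh of the partition tends to `0`. -/
def HasYoungIntegral {V W : Type*} [NormedAddCommGroup W] (G : ℝ → V → W) (f : ℝ → V)
    (s t : ℝ) (L : W) : Prop :=
  ∀ ε > 0, ∃ δ > 0, ∀ P : IntervalPartition s t, P.MeshLt δ → ‖RiemannSum G f P - L‖ < ε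

/-- Riemann sums `Σ_i (σ^w_{[t_i,t_{i+1}]} b)(θ_{t_i})`. -/
def sigmaRiemannSum {d : ℕ} (w : ℝ → Euc d) (bhat : ℝ × Euc d → Fin d → ℂ)
    (θ : ℝ → Euc d) {s t : ℝ} (P : IntervalPartition s t) : Euc d :=
  ∑ i ∈ Finset.range P.n, sigmaAvg w bhat (P.pts i) (P.pts (i + 1)) (θ (P.pts i))

/-- `L = ∫_s^t (σ^w_{du} b)(θ_u)` as a limit of Riemann sums. -/
def HasSigmaIntegral {d : ℕ} (w : ℝ → Euc d) (bhat : ℝ × Euc d → Fin d → ℂ)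
    (θ : ℝ → Euc d) (s t : ℝ) (L : Euc d) : Prop :=
  ∀ ε > 0, ∃ δ > 0, ∀ P : IntervalPartition s t, P.MeshLt δ → ‖sigmaRiemannSum w bhat θ P - L‖ < ε

/-- `θ` solves the Young equation `θ_t = x₀ + ∫_0^t (σ^w_{du} b)(θ_u)` on `[0,1]`. -/
def SolvesSigmaYoung {d : ℕ} (w : ℝ → Euc d) (bhat : ℝ × Euc d → Fin d → ℂ)
    (x₀ : Euc d) (θ : ℝ → Euc d) : Prop :=
  θ 0 = x₀ ∧ ∀ t ∈ Set.Icc (0 : ℝ) 1, HasSigmaIntegral w bhat θ 0 t (θ t - x₀)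

/-- `γ`-Hölder continuity on `[0,1]`. -/
def HolderOnIcc {E : Type*} [NormedAddCommGroup E] (γ : ℝ) (f : ℝ → E) : Prop :=
  ∃ C : ℝ, ∀ s ∈ Set.Icc (0 : ℝ) 1, ∀ t ∈ Set.Icc (0 : ℝ) 1, ‖f t - f s‖ ≤ C * |t - s| ^ γ

/-- Covariance of the fractional Brownian motion of Hurst index `H`. -/
def fbmCov (H : ℝ) (s t : ℝ) : ℝ := (s ^ (2 * H) + t ^ (2 * H) - |t - s| ^ (2 * H)) / 2

/-- `W` is a `d`-dimensional fractional Brownian motion of Hurst parameter `H` with continuous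
sample paths: the coordinates are independent centered Gaussian processes with the fBm
covariance, expressed by asking every finite linear combination to be Gaussian. -/
def IsFBM {Ω : Type*} [MeasureSpace Ω] (d : ℕ) (H : ℝ) (W : Ω → ℝ → Euc d) : Prop :=
  (∀ ω, ContinuousOn (W ω) (Set.Icc 0 1)) ∧
  (∀ t, Measurable fun ω => W ω t) ∧
  (∀ ω, W ω 0 = 0) ∧
  ∀ (n : ℕ) (c : Fin n → ℝ) (t : Fin n → ℝ) (j : Fin n → Fin d),
    (∀ k, t k ∈ Set.Icc (0 : ℝ) 1) →
    Measure.map (fun ω => ∑ k, c k * W ω (t k) (j k)) (volume : Measure Ω) =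
      ProbabilityTheory.gaussianReal 0
        (Real.toNNReal (∑ k, ∑ l, c k * c l *
          (if j k = j l then fbmCov H (t k) (t l) else 0)))

/-- `R^w_λ = (∫_0^1 exp(λ |w_u|²) du)^{1/λ}`. -/
def Rconst {d : ℕ} (lam : ℝ) (w : ℝ → Euc d) : ℝ≥0∞ :=
  (∫⁻ u in Set.Icc (0 : ℝ) 1, ENNReal.ofReal (Real.exp (lam * ‖w u‖ ^ 2))) ^ (1 / lam)

/-- `S^w_λ`. -/
def Sconst {d : ℕ} (H lam : ℝ) (w : ℝ → Euc d) : ℝ≥0∞ :=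
  (∑' n : ℕ, ∑' m : ℕ, ∑ k ∈ Finset.range (2 ^ n), ∑' q : ℤ × (Fin d → ℤ),
    ENNReal.ofReal (
      (2 : ℝ) ^ (-(2 * (n : ℝ)) - (m : ℝ) * ((d : ℝ) + 2)) *
      (1 + |(q.1 : ℝ) / 2 ^ m|) ^ (-(2 : ℝ)) *
      (1 + ‖(EuclideanSpace.equiv (Fin d) ℝ).symm (fun i => (q.2 i : ℝ) / 2 ^ m)‖) ^
        (-((d : ℝ) + 1)) *
      Real.exp (lam * 2 ^ n *
        (1 + ‖(EuclideanSpace.equiv (Fin d) ℝ).symm (fun i => (q.2 i : ℝ) / 2 ^ m)‖) ^ (1 / H) *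
        ‖Yint w ((k : ℝ) / 2 ^ n) (((k : ℝ) + 1) / 2 ^ n) ((q.1 : ℝ) / 2 ^ m)
          ((EuclideanSpace.equiv (Fin d) ℝ).symm (fun i => (q.2 i : ℝ) / 2 ^ m))‖ ^ 2))) ^
  (1 / lam)

/-- `Q^w_λ = √(log S^w_λ) + √(log R^w_λ)`. -/
def Qconst {d : ℕ} (H lam : ℝ) (w : ℝ → Euc d) : ℝ :=
  Real.sqrt (Real.log (Sconst H lam w).toReal) + Real.sqrt (Real.log (Rconst lam w).toReal)


section LocalNondeterminism

open Real

theorem integrable_of_even_of_integrableOn_Ioi {g : ℝ → ℝ} (heven : ∀ x, g (-x) = g x)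
    (hg : IntegrableOn g (Set.Ioi 0)) : Integrable g := by
  have hneg : IntegrableOn g (Set.Iio 0) := by
    have h := ((Measure.measurePreserving_neg (volume : Measure ℝ)).integrableOn_comp_preimage
      (Homeomorph.neg ℝ).measurableEmbedding (f := g) (s := Set.Ioi 0)).2 hg
    have h1 : g ∘ Neg.neg = g := funext heven
    have h2 : (Neg.neg : ℝ → ℝ) ⁻¹' Set.Ioi 0 = Set.Iio 0 := by ext x; simp
    rwa [h1, h2] at h
  rw [← integrableOn_univ, ← Set.Iic_union_Ioi (a := (0 : ℝ))]
  exact ((integrableOn_Iic_iff_integrableOn_Iio (by finiteness)).2 hneg).union hg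

theorem integrable_one_sub_cos_mul_rpow {H : ℝ} (hH : 0 < H) (hH1 : H < 1) (a : ℝ) :
    Integrable fun x : ℝ => (1 - cos (a * x)) * |x| ^ (-1 - 2 * H) := by
  refine integrable_of_even_of_integrableOn_Ioi (fun x => by simp) ?_
  have hmeas : Measurable fun x : ℝ => (1 - cos (a * x)) * |x| ^ (-1 - 2 * H) := by fun_prop
  rw [← Set.Ioc_union_Ioi_eq_Ioi zero_le_one]
  refine IntegrableOn.union ?_ ?_
  · have h : IntegrableOn (fun x : ℝ => a ^ 2 / 2 * x ^ (1 - 2 * H)) (Set.Ioc 0 1) := by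
      rw [← intervalIntegrable_iff_integrableOn_Ioc_of_le zero_le_one]
      exact (intervalIntegral.intervalIntegrable_rpow' (by linarith)).const_mul _
    refine h.mono' hmeas.aestronglyMeasurable ?_
    filter_upwards [ae_restrict_mem measurableSet_Ioc] with x hx
    have hx0 : 0 < x := hx.1
    have hc : 1 - cos (a * x) ≤ a ^ 2 / 2 * x ^ 2 := by
      have := one_sub_sq_div_two_le_cos (x := a * x)
      nlinarith
    rw [abs_of_pos hx0, norm_mul, norm_of_nonneg (rpow_nonneg hx0.le _),
      norm_of_nonneg (by linarith [cos_le_one (a * x)])]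
    have h2 : x ^ (1 - 2 * H) = x ^ 2 * x ^ (-1 - 2 * H) := by
      rw [← rpow_natCast x 2, ← rpow_add hx0]; congr 1; push_cast; ring
    rw [h2, ← mul_assoc]
    exact mul_le_mul_of_nonneg_right hc (rpow_nonneg hx0.le _)
  · have h : IntegrableOn (fun x : ℝ => 2 * x ^ (-1 - 2 * H)) (Set.Ioi 1) :=
      (integrableOn_Ioi_rpow_of_lt (by linarith) zero_lt_one).const_mul _
    refine h.mono' hmeas.aestronglyMeasurable ?_
    filter_upwards [ae_restrict_mem measurableSet_Ioi] with x hx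
    have hx0 : 0 < x := zero_lt_one.trans hx
    rw [abs_of_pos hx0, norm_mul, norm_of_nonneg (rpow_nonneg hx0.le _),
      norm_of_nonneg (by linarith [cos_le_one (a * x)])]
    exact mul_le_mul_of_nonneg_right (by linarith [neg_one_le_cos (a * x)])
      (rpow_nonneg hx0.le _)

/-- The normalising constant `∫ (1 - cos 2πx) |x|^{-1-2H} dx` of the spectral density. -/
def spectralConst (H : ℝ) : ℝ := ∫ x : ℝ, (1 - cos (2 * π * x)) * |x| ^ (-1 - 2 * H)

theorem integral_one_sub_cos_mul_rpow {H : ℝ} (hH : 0 < H) (a : ℝ) :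
    ∫ x : ℝ, (1 - cos (2 * π * a * x)) * |x| ^ (-1 - 2 * H) =
      |a| ^ (2 * H) * spectralConst H := by
  rcases eq_or_ne a 0 with rfl | ha
  · rw [abs_zero, zero_rpow (by positivity)]; simp
  · have hpos : 0 < |a| := abs_pos.2 ha
    have h := Measure.integral_comp_mul_left
      (fun x : ℝ => (1 - cos (2 * π * x)) * |x| ^ (-1 - 2 * H)) a
    have h1 : ∀ x : ℝ, (1 - cos (2 * π * a * x)) * |x| ^ (-1 - 2 * H) =
        |a| ^ (1 + 2 * H) * ((1 - cos (2 * π * (a * x))) * |a * x| ^ (-1 - 2 * H)) := by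
      intro x
      have h2 : |a| ^ (1 + 2 * H) * |a| ^ (-1 - 2 * H) = 1 := by
        rw [← rpow_add hpos, show 1 + 2 * H + (-1 - 2 * H) = 0 by ring, rpow_zero]
      rw [abs_mul, mul_rpow (abs_nonneg a) (abs_nonneg x), mul_assoc (2 * π)]
      linear_combination (-(1 - cos (2 * π * (a * x))) * |x| ^ (-1 - 2 * H)) * h2
    simp_rw [h1]
    rw [integral_const_mul, h, abs_inv, smul_eq_mul, ← mul_assoc, rpow_add hpos, rpow_one,
      spectralConst]
    field_simp

/-- The variance `∑ₖ ∑ₗ cₖ cₗ R(aₖ, aₗ)` of `∑ₖ cₖ B(aₖ)` for a fractional Brownian motion. -/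
def fbmForm (H : ℝ) {ι : Type*} [Fintype ι] (c a : ι → ℝ) : ℝ :=
  ∑ k, ∑ l, c k * c l * fbmCov H (a k) (a l)

/-- The spectral representative `∑ₖ cₖ (e^{2πi aₖ y} - 1)` of `∑ₖ cₖ B(aₖ)`. -/
def spectralSum {ι : Type*} [Fintype ι] (c a : ι → ℝ) (y : ℝ) : ℂ :=
  ∑ k, (c k : ℂ) * (Complex.exp ((2 * π * (y * a k) : ℝ) * Complex.I) - 1)

theorem sq_norm_spectralSum {ι : Type*} [Fintype ι] (c a : ι → ℝ) (y : ℝ) :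
    ‖spectralSum c a y‖ ^ 2 = ∑ k, ∑ l, c k * c l *
      ((1 - cos (2 * π * a k * y)) + (1 - cos (2 * π * a l * y)) -
        (1 - cos (2 * π * (a l - a k) * y))) := by
  have hre : (spectralSum c a y).re = ∑ k, c k * (cos (2 * π * a k * y) - 1) := by
    simp only [spectralSum, Complex.re_sum, Complex.re_ofReal_mul, Complex.sub_re,
      Complex.exp_ofReal_mul_I_re, Complex.one_re]
    exact Finset.sum_congr rfl fun k _ => by ring_nf
  have him : (spectralSum c a y).im = ∑ k, c k * sin (2 * π * a k * y) := by
    simp only [spectralSum, Complex.im_sum, Complex.im_ofReal_mul, Complex.sub_im,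
      Complex.exp_ofReal_mul_I_im, Complex.one_im]
    exact Finset.sum_congr rfl fun k _ => by ring_nf
  rw [← Complex.normSq_eq_norm_sq, Complex.normSq_apply, hre, him, Finset.sum_mul_sum,
    Finset.sum_mul_sum, ← Finset.sum_add_distrib]
  refine Finset.sum_congr rfl fun k _ => ?_
  rw [← Finset.sum_add_distrib]
  refine Finset.sum_congr rfl fun l _ => ?_
  rw [show 2 * π * (a l - a k) * y = 2 * π * a l * y - 2 * π * a k * y by ring, cos_sub]
  ring

theorem integrable_spectral_term {H : ℝ} (hH : 0 < H) (hH1 : H < 1) (x y z C : ℝ) :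
    Integrable fun r : ℝ => C * ((1 - cos (x * r)) + (1 - cos (y * r)) - (1 - cos (z * r))) *
      |r| ^ (-1 - 2 * H) := by
  have h := ((((integrable_one_sub_cos_mul_rpow hH hH1 x).add
    (integrable_one_sub_cos_mul_rpow hH hH1 y)).sub
    (integrable_one_sub_cos_mul_rpow hH hH1 z)).const_mul C)
  refine h.congr (Eventually.of_forall fun r => ?_)
  simp only [Pi.add_apply, Pi.sub_apply]
  ring

theorem integrable_sq_norm_spectralSum {H : ℝ} (hH : 0 < H) (hH1 : H < 1) {ι : Type*} [Fintype ι]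
    (c a : ι → ℝ) : Integrable fun y : ℝ => ‖spectralSum c a y‖ ^ 2 * |y| ^ (-1 - 2 * H) := by
  simp_rw [sq_norm_spectralSum, Finset.sum_mul]
  exact integrable_finsetSum _ fun k _ => integrable_finsetSum _ fun l _ =>
    integrable_spectral_term hH hH1 _ _ _ _

theorem integral_sq_norm_spectralSum {H : ℝ} (hH : 0 < H) (hH1 : H < 1) {ι : Type*} [Fintype ι]
    (c a : ι → ℝ) (ha : ∀ k, 0 ≤ a k) :
    ∫ y : ℝ, ‖spectralSum c a y‖ ^ 2 * |y| ^ (-1 - 2 * H) =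
      2 * spectralConst H * fbmForm H c a := by
  simp_rw [sq_norm_spectralSum, Finset.sum_mul]
  rw [integral_finsetSum _ fun k _ => integrable_finsetSum _ fun l _ =>
    integrable_spectral_term hH hH1 _ _ _ _, fbmForm, Finset.mul_sum]
  refine Finset.sum_congr rfl fun k _ => ?_
  rw [integral_finsetSum _ fun l _ => integrable_spectral_term hH hH1 _ _ _ _, Finset.mul_sum]
  refine Finset.sum_congr rfl fun l _ => ?_
  have h1 := integrable_one_sub_cos_mul_rpow hH hH1 (2 * π * a k)
  have h2 := integrable_one_sub_cos_mul_rpow hH hH1 (2 * π * a l)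
  have h3 := integrable_one_sub_cos_mul_rpow hH hH1 (2 * π * (a l - a k))
  have hterm : ∀ y : ℝ, c k * c l * ((1 - cos (2 * π * a k * y)) + (1 - cos (2 * π * a l * y)) -
      (1 - cos (2 * π * (a l - a k) * y))) * |y| ^ (-1 - 2 * H) =
      c k * c l * ((1 - cos (2 * π * a k * y)) * |y| ^ (-1 - 2 * H) +
        (1 - cos (2 * π * a l * y)) * |y| ^ (-1 - 2 * H) -
        (1 - cos (2 * π * (a l - a k) * y)) * |y| ^ (-1 - 2 * H)) := fun y => by ring
  simp_rw [hterm]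
  rw [integral_const_mul, integral_sub (by exact h1.add h2) h3, integral_add h1 h2,
    integral_one_sub_cos_mul_rpow hH, integral_one_sub_cos_mul_rpow hH,
    integral_one_sub_cos_mul_rpow hH, abs_of_nonneg (ha k), abs_of_nonneg (ha l), fbmCov]
  ring

open FourierTransform in
/-- An integrable function `g` whose inverse Fourier transform is a bump function. -/
theorem exists_fourier_bump (H : ℝ) (hH : 0 < H) (hH1 : H < 1) :
    ∃ g : ℝ → ℂ, Continuous g ∧ Integrable g ∧
      Integrable (fun y => ‖g y‖ ^ 2 * |y| ^ (1 + 2 * H)) ∧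
      (∫ y, Complex.exp ((2 * π * (y * 0) : ℝ) * Complex.I) * g y = 1) ∧
      ∀ w : ℝ, 1 ≤ |w| → ∫ y, Complex.exp ((2 * π * (y * w) : ℝ) * Complex.I) * g y = 0 := by
  let b : ContDiffBump (0 : ℝ) := ⟨1 / 2, 1, by norm_num, by norm_num⟩
  have hcs : HasCompactSupport fun x : ℝ => ((b x : ℝ) : ℂ) :=
    b.hasCompactSupport.comp_left (g := ((↑) : ℝ → ℂ)) Complex.ofReal_zero
  have hsm : ContDiff ℝ (⊤ : ℕ∞) fun x : ℝ => ((b x : ℝ) : ℂ) :=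
    Complex.ofRealCLM.contDiff.comp b.contDiff
  let φ : SchwartzMap ℝ ℂ := hcs.toSchwartzMap hsm
  let g : SchwartzMap ℝ ℂ := 𝓕 φ
  have hinv : ∀ w : ℝ, ∫ y, Complex.exp ((2 * π * (y * w) : ℝ) * Complex.I) * g y = (b w : ℂ) := by
    intro w
    have h1 : (𝓕⁻ g) = φ := FourierTransform.fourierInv_fourier_eq φ
    have h2 : (𝓕⁻ (g : ℝ → ℂ)) w = φ w := by rw [← SchwartzMap.fourierInv_coe, h1]
    rw [Real.fourierInv_eq'] at h2
    have h3 : φ w = (b w : ℂ) := rfl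
    rw [← h3, ← h2]
    simp [mul_comm, mul_left_comm, mul_assoc]
  refine ⟨g, g.continuous, g.integrable, ?_, ?_, ?_⟩
  · obtain ⟨M, hM⟩ : ∃ M, ∀ y, ‖g y‖ ≤ M := ⟨_, g.norm_le_seminorm ℝ⟩
    have h0 := g.integrable_pow_mul volume 0
    have h3 := g.integrable_pow_mul volume 3
    refine ((h0.add h3).const_mul M).mono'
      (by have := g.continuous; exact (by fun_prop : Measurable _).aestronglyMeasurable)
      (Eventually.of_forall fun y => ?_)
    have hy : |y| ^ (1 + 2 * H) ≤ 1 + |y| ^ 3 := by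
      rcases le_total |y| 1 with h | h
      · have := rpow_le_one (abs_nonneg y) h (by linarith : 0 ≤ 1 + 2 * H)
        have : 0 ≤ |y| ^ 3 := by positivity
        linarith
      · have := rpow_le_rpow_of_exponent_le h (by push_cast; linarith : 1 + 2 * H ≤ ((3 : ℕ) : ℝ))
        rw [rpow_natCast] at this
        linarith
    rw [norm_of_nonneg (by positivity)]
    simp only [Pi.add_apply, pow_zero, one_mul, Real.norm_eq_abs]
    have hg := norm_nonneg (g y)
    have hM0 : 0 ≤ M := hg.trans (hM y)
    calc ‖g y‖ ^ 2 * |y| ^ (1 + 2 * H) ≤ (M * ‖g y‖) * (1 + |y| ^ 3) := by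
          rw [pow_two]
          gcongr
          exact hM y
      _ = _ := by ring
  · rw [hinv, b.one_of_mem_closedBall (by simp [b])]; simp
  · intro w hw
    rw [hinv, b.zero_of_le_dist (by simpa [b] using hw)]; simp

theorem exists_integral_spectralSum_lower_bound {H : ℝ} (hH : 0 < H) (hH1 : H < 1) :
    ∃ κ : ℝ, 0 < κ ∧ ∀ {ι : Type} [Fintype ι] (c a : ι → ℝ) (k₀ : ι), c k₀ = 1 → 1 ≤ a k₀ →
      (∀ k, k ≠ k₀ → a k + 1 ≤ a k₀) →
      κ ≤ ∫ y : ℝ, ‖spectralSum c a y‖ ^ 2 * |y| ^ (-1 - 2 * H) := by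
  classical
  obtain ⟨g, hgc, hgi, hg2, hg0, hg1⟩ := exists_fourier_bump H hH hH1
  set B : ℝ := ∫ y, ‖g y‖ ^ 2 * |y| ^ (1 + 2 * H)
  have hB : 0 ≤ B := integral_nonneg fun y => by positivity
  refine ⟨1 / (B + 1), by positivity, fun {ι} _ c a k₀ hc ha0 ha => ?_⟩
  set u := a k₀
  have hker : ∀ w : ℝ,
      Integrable fun y => Complex.exp ((2 * π * (y * w) : ℝ) * Complex.I) * g y := by
    intro w
    refine hgi.norm.mono' (by fun_prop) (Eventually.of_forall fun y => ?_)
    rw [norm_mul, Complex.norm_exp_ofReal_mul_I, one_mul]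
  have hval : ∫ y, Complex.exp ((2 * π * (y * (-u)) : ℝ) * Complex.I) * g y *
      spectralSum c a y = 1 := by
    have hexp : ∀ y, Complex.exp ((2 * π * (y * (-u)) : ℝ) * Complex.I) * g y *
        spectralSum c a y = ∑ k, (c k : ℂ) *
          (Complex.exp ((2 * π * (y * (a k - u)) : ℝ) * Complex.I) * g y -
            Complex.exp ((2 * π * (y * (-u)) : ℝ) * Complex.I) * g y) := by
      intro y
      rw [spectralSum, Finset.mul_sum]
      refine Finset.sum_congr rfl fun k _ => ?_
      have : Complex.exp ((2 * π * (y * (a k - u)) : ℝ) * Complex.I) =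
          Complex.exp ((2 * π * (y * (-u)) : ℝ) * Complex.I) *
            Complex.exp ((2 * π * (y * a k) : ℝ) * Complex.I) := by
        rw [← Complex.exp_add]; congr 1; push_cast; ring
      rw [this]; ring
    simp_rw [hexp]
    rw [integral_finsetSum _ fun k _ => by exact ((hker _).sub (hker _)).const_mul _]
    have hterm : ∀ k, ∫ y, (c k : ℂ) *
          (Complex.exp ((2 * π * (y * (a k - u)) : ℝ) * Complex.I) * g y -
            Complex.exp ((2 * π * (y * (-u)) : ℝ) * Complex.I) * g y) =
          if k = k₀ then 1 else 0 := by
      intro k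
      rw [integral_const_mul, integral_sub (hker _) (hker _),
        hg1 (-u) (by rw [abs_neg]; exact ha0.trans (le_abs_self _)), sub_zero]
      split_ifs with hk
      · rw [hk, show a k₀ - u = 0 from sub_self _, hg0, hc]; simp
      · rw [hg1, mul_zero]
        rw [abs_sub_comm]
        exact le_trans (by linarith [ha k hk]) (le_abs_self _)
    rw [Finset.sum_congr rfl fun k _ => hterm k]
    simp
  have hA := integrable_sq_norm_spectralSum hH hH1 c a
  set A : ℝ := ∫ y : ℝ, ‖spectralSum c a y‖ ^ 2 * |y| ^ (-1 - 2 * H)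
  have hle : (1 : ℝ) ≤ (B + 1) / 2 * A + 1 / (2 * (B + 1)) * B := by
    calc (1 : ℝ) = ‖∫ y, Complex.exp ((2 * π * (y * (-u)) : ℝ) * Complex.I) * g y *
          spectralSum c a y‖ := by rw [hval, norm_one]
      _ ≤ ∫ y, ((B + 1) / 2 * (‖spectralSum c a y‖ ^ 2 * |y| ^ (-1 - 2 * H)) +
            1 / (2 * (B + 1)) * (‖g y‖ ^ 2 * |y| ^ (1 + 2 * H))) := by
          refine norm_integral_le_of_norm_le ((hA.const_mul _).add (hg2.const_mul _)) ?_
          have hae : ∀ᵐ y : ℝ, y ≠ 0 := by simp [ae_iff]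
          filter_upwards [hae] with y hy
          rw [norm_mul, norm_mul, Complex.norm_exp_ofReal_mul_I, one_mul]
          have hypos : 0 < |y| := abs_pos.2 hy
          set w := |y| ^ (1 + 2 * H)
          have hw : 0 < w := rpow_pos_of_pos hypos _
          have hw' : |y| ^ (-1 - 2 * H) = w⁻¹ := by
            rw [← rpow_neg hypos.le]; congr 1; ring
          rw [hw']
          set p := ‖g y‖
          set q := ‖spectralSum c a y‖
          have hsq : 0 ≤ ((B + 1) * q - p * w) ^ 2 / (2 * (B + 1) * w) := by positivity
          have : (B + 1) / 2 * (q ^ 2 * w⁻¹) + 1 / (2 * (B + 1)) * (p ^ 2 * w) - p * q =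
              ((B + 1) * q - p * w) ^ 2 / (2 * (B + 1) * w) := by
            field_simp; ring
          linarith
      _ = _ := by
          rw [integral_add (hA.const_mul _) (hg2.const_mul _), integral_const_mul,
            integral_const_mul]
  have h2 : 1 / (2 * (B + 1)) * B ≤ 1 / 2 := by
    rw [one_div_mul_eq_div, div_le_div_iff₀ (by positivity) (by norm_num)]; linarith
  rw [div_le_iff₀ (by positivity)]
  nlinarith

theorem fbmCov_mul {H r : ℝ} (hr : 0 ≤ r) {s t : ℝ} (hs : 0 ≤ s) (ht : 0 ≤ t) :
    fbmCov H (r * s) (r * t) = r ^ (2 * H) * fbmCov H s t := by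
  rw [fbmCov, fbmCov, ← mul_sub, abs_mul, abs_of_nonneg hr, mul_rpow hr hs, mul_rpow hr ht,
    mul_rpow hr (abs_nonneg _)]
  ring

theorem fbmForm_mul {H r : ℝ} (hr : 0 ≤ r) {ι : Type*} [Fintype ι] (c a : ι → ℝ)
    (ha : ∀ k, 0 ≤ a k) : fbmForm H c (fun k => r * a k) = r ^ (2 * H) * fbmForm H c a := by
  simp only [fbmForm, Finset.mul_sum]
  refine Finset.sum_congr rfl fun k _ => Finset.sum_congr rfl fun l _ => ?_
  rw [fbmCov_mul hr (ha k) (ha l)]; ring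

/-- Local nondeterminism of fractional Brownian motion: the value at time `u` keeps a conditional
variance of order `(u - v)^{2H}` given finitely many values at times in `[0, v]`. -/
theorem exists_fbmForm_lower_bound {H : ℝ} (hH : 0 < H) (hH1 : H < 1) :
    ∃ κ : ℝ, 0 < κ ∧ ∀ {ι : Type} [Fintype ι] (c a : ι → ℝ) (k₀ : ι) (v : ℝ), c k₀ = 1 →
      0 ≤ v → v < a k₀ → (∀ k, 0 ≤ a k) → (∀ k, k ≠ k₀ → a k ≤ v) →
      κ * (a k₀ - v) ^ (2 * H) ≤ fbmForm H c a := by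
  obtain ⟨κ, hκ, hlow⟩ := exists_integral_spectralSum_lower_bound hH hH1
  have hJ : 0 < spectralConst H := by
    have h := hlow (ι := Unit) (fun _ => 1) (fun _ => 1) () rfl le_rfl
      (fun k hk => absurd (Subsingleton.elim _ _) hk)
    rw [integral_sq_norm_spectralSum hH hH1 _ _ (fun _ => zero_le_one)] at h
    have h1 : fbmForm H (fun _ : Unit => (1 : ℝ)) (fun _ => 1) = 1 := by
      simp [fbmForm, fbmCov, zero_rpow (by positivity : 2 * H ≠ 0)]
    rw [h1] at h
    linarith
  refine ⟨κ / (2 * spectralConst H), by positivity, fun {ι} _ c a k₀ v hc hv huv ha0 hav => ?_⟩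
  set r := a k₀ - v
  have hr : 0 < r := sub_pos.2 huv
  have hle : ∀ {x y : ℝ}, x ≤ y → r⁻¹ * x ≤ r⁻¹ * y := fun h =>
    mul_le_mul_of_nonneg_left h (inv_pos.2 hr).le
  have hrr : r⁻¹ * r = 1 := inv_mul_cancel₀ hr.ne'
  have ha0' : ∀ k, 0 ≤ r⁻¹ * a k := fun k => mul_nonneg (inv_pos.2 hr).le (ha0 k)
  have h := hlow c (fun k => r⁻¹ * a k) k₀ hc
    (by rw [← hrr]; exact hle (by simp only [r]; linarith))
    (fun k hk => by
      rw [← hrr, ← mul_add]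
      exact hle (by simp only [r]; linarith [hav k hk]))
  rw [integral_sq_norm_spectralSum hH hH1 _ _ ha0'] at h
  have hscale : fbmForm H c a = r ^ (2 * H) * fbmForm H c fun k => r⁻¹ * a k := by
    rw [← fbmForm_mul hr.le _ _ ha0']
    congr 1
    ext k
    rw [← mul_assoc, mul_inv_cancel₀ hr.ne', one_mul]
  rw [hscale, mul_comm]
  refine mul_le_mul_of_nonneg_left ?_ (by positivity)
  rw [div_le_iff₀ (by positivity)]
  linarith

end LocalNondeterminism

section GaussianConditioning

open ProbabilityTheory

variable {Ω : Type*} [MeasurableSpace Ω] {μ : Measure Ω}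

theorem exists_inner_sub_sum_smul_eq_zero {E ι : Type*} [NormedAddCommGroup E]
    [InnerProductSpace ℝ E] [Fintype ι] (F : ι → E) (g : E) :
    ∃ b : ι → ℝ, ∀ k, inner ℝ (F k) (g - ∑ j, b j • F j) = 0 := by
  let S : Submodule ℝ E := Submodule.span ℝ (Set.range F)
  have : FiniteDimensional ℝ S := FiniteDimensional.span_of_finite ℝ (Set.finite_range F)
  obtain ⟨b, hb⟩ := (Submodule.mem_span_range_iff_exists_fun ℝ).1
    (S.starProjection_apply_mem g)
  refine ⟨b, fun k => ?_⟩
  rw [hb]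
  exact (S.mem_orthogonal _).1 (S.sub_starProjection_mem_orthogonal _) _
    (Submodule.subset_span ⟨k, rfl⟩)

theorem exists_orthogonal_residual {ι : Type*} [Fintype ι] {f : ι → Ω → ℝ} {g : Ω → ℝ}
    (hf : ∀ k, MemLp (f k) 2 μ) (hg : MemLp g 2 μ) :
    ∃ b : ι → ℝ, ∀ k, ∫ x, (g x - ∑ j, b j * f j x) * f k x ∂μ = 0 := by
  have hinner : ∀ {p q : Ω → ℝ} (hp : MemLp p 2 μ) (hq : MemLp q 2 μ),
      inner ℝ (hp.toLp p) (hq.toLp q) = ∫ x, q x * p x ∂μ := by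
    intro p q hp hq
    rw [L2.inner_def]
    refine integral_congr_ae ?_
    filter_upwards [hp.coeFn_toLp, hq.coeFn_toLp] with x h1 h2
    simp [h1, h2]
  obtain ⟨b, hb⟩ := exists_inner_sub_sum_smul_eq_zero (fun k => (hf k).toLp (f k)) (hg.toLp g)
  refine ⟨b, fun k => ?_⟩
  have horth := hb k
  rw [inner_sub_right, inner_sum] at horth
  simp_rw [inner_smul_right] at horth
  simp only [hinner] at horth
  have hi : ∀ {p q : Ω → ℝ}, MemLp p 2 μ → MemLp q 2 μ → Integrable (fun x => p x * q x) μ :=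
    fun hp hq => hp.integrable_mul hq
  simp_rw [sub_mul, Finset.sum_mul, mul_assoc]
  rw [integral_sub (hi hg (hf k))
    (integrable_finsetSum _ fun j _ => (hi (hf j) (hf k)).const_mul _),
    integral_finsetSum _ fun j _ => (hi (hf j) (hf k)).const_mul _]
  simp_rw [integral_const_mul]
  exact horth

/-- A centred Gaussian process on `[0, 1]` with continuous paths and the covariance of `σ` times a
fractional Brownian motion. -/
structure IsScaledFBM (H σ : ℝ) (X : Ω → ℝ → ℝ) (μ : Measure Ω) : Prop where
  continuous_path : ∀ x, Continuous (X x)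
  measurable_eval : ∀ t, Measurable fun x => X x t
  map_sum : ∀ {ι : Type} [Fintype ι] (c a : ι → ℝ), (∀ k, a k ∈ Set.Icc (0 : ℝ) 1) →
    μ.map (fun x => ∑ k, c k * X x (a k)) =
      gaussianReal 0 (Real.toNNReal (σ ^ 2 * fbmForm H c a))

namespace IsScaledFBM

variable {H σ : ℝ} {X : Ω → ℝ → ℝ}

theorem hasGaussianLaw (hX : IsScaledFBM H σ X μ) {ι : Type} [Fintype ι] (a : ι → ℝ)
    (ha : ∀ k, a k ∈ Set.Icc (0 : ℝ) 1) : HasGaussianLaw (fun x k => X x (a k)) μ where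
  isGaussian_map := by
    classical
    have hm : Measurable fun x k => X x (a k) :=
      measurable_pi_lambda _ fun k => hX.measurable_eval _
    refine isGaussian_of_map_eq_gaussianReal fun L =>
      ⟨0, Real.toNNReal (σ ^ 2 * fbmForm H (fun k => L (Pi.single k 1)) a), ?_⟩
    rw [Measure.map_map (by fun_prop) hm, ← hX.map_sum (fun k => L (Pi.single k 1)) a ha]
    refine congrArg (Measure.map · μ) (funext fun x => ?_)
    have h := L.toLinearMap.pi_apply_eq_sum_univ (fun k => X x (a k))
    simp only [Function.comp_apply]
    refine h.trans (Finset.sum_congr rfl fun k _ => ?_)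
    rw [smul_eq_mul, mul_comm]
    refine congrArg (fun e => L e * X x (a k)) (funext fun j => ?_)
    simp [Pi.single_apply, eq_comm]

theorem integral_eval (hX : IsScaledFBM H σ X μ) {t : ℝ} (ht : t ∈ Set.Icc (0 : ℝ) 1) :
    ∫ x, X x t ∂μ = 0 := by
  have h := hX.map_sum (fun _ : Unit => 1) (fun _ => t) fun _ => ht
  simp only [Finset.univ_unique, Finset.sum_singleton, one_mul] at h
  have h2 := integral_map (μ := μ) (hX.measurable_eval t).aemeasurable
    (f := fun y : ℝ => y) (by fun_prop)
  rw [← h2, h, integral_id_gaussianReal]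

/-- Conditioning on values at finitely many times in `[0, v]` and averaging `e^{i X_u}` gains the
Gaussian factor coming from the conditional variance. -/
theorem norm_integral_mul_exp_le [IsProbabilityMeasure μ] (hX : IsScaledFBM H σ X μ)
    (hH : 0 < H) {κ : ℝ}
    (hκ : ∀ {ι : Type} [Fintype ι] (c a : ι → ℝ) (k₀ : ι) (v : ℝ), c k₀ = 1 →
      0 ≤ v → v < a k₀ → (∀ k, 0 ≤ a k) → (∀ k, k ≠ k₀ → a k ≤ v) →
      κ * (a k₀ - v) ^ (2 * H) ≤ fbmForm H c a)
    {u v : ℝ} (hv : 0 ≤ v) (hvu : v ≤ u) (hu : u ≤ 1) {ι : Type} [Fintype ι] (τ : ι → ℝ)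
    (hτ : ∀ k, τ k ∈ Set.Icc 0 v) {Φ : (ι → ℝ) → ℂ} (hΦ : Measurable Φ) :
    ‖∫ x, Φ (fun k => X x (τ k)) * Complex.exp (X x u * Complex.I) ∂μ‖ ≤
      Real.exp (-(σ ^ 2 * κ / 2 * (u - v) ^ (2 * H))) * ∫ x, ‖Φ (fun k => X x (τ k))‖ ∂μ := by
  have hexp1 : ∀ y : ℝ, ‖Complex.exp (y * Complex.I)‖ = 1 := Complex.norm_exp_ofReal_mul_I
  rcases hvu.eq_or_lt with rfl | hlt
  · rw [sub_self, Real.zero_rpow (by positivity), mul_zero, neg_zero, Real.exp_zero, one_mul]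
    refine (norm_integral_le_integral_norm _).trans (le_of_eq ?_)
    simp_rw [norm_mul, hexp1, mul_one]
  have hτ1 : ∀ k, τ k ∈ Set.Icc (0 : ℝ) 1 := fun k => ⟨(hτ k).1, (hτ k).2.trans (hvu.trans hu)⟩
  have hu1 : u ∈ Set.Icc (0 : ℝ) 1 := ⟨hv.trans hvu, hu⟩
  let a : Option ι → ℝ := fun o => o.elim u τ
  have ha : ∀ o, a o ∈ Set.Icc (0 : ℝ) 1 := by
    rintro (_ | k)
    · exact hu1
    · exact hτ1 k
  have hlaw := hX.hasGaussianLaw a ha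
  have hL2 : ∀ o, MemLp (fun x => X x (a o)) 2 μ := fun o =>
    (HasGaussianLaw.eval (X := fun o x => X x (a o)) hlaw o).memLp_two
  obtain ⟨b, hb⟩ := exists_orthogonal_residual (fun k => hL2 (some k)) (hL2 none)
  change ∀ k, ∫ x, (X x u - ∑ j, b j * X x (τ j)) * X x (τ k) ∂μ = 0 at hb
  let N : Ω → ℝ := fun x => X x u - ∑ j, b j * X x (τ j)
  have hmeas := hX.measurable_eval
  have hNm : Measurable N := by fun_prop
  have hvm : Measurable fun x k => X x (τ k) := by fun_prop
  have hindep : IndepFun (fun x k => X x (τ k)) (fun x (_ : Unit) => N x) μ := by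
    refine HasGaussianLaw.indepFun_of_covariance_eval (X := fun k x => X x (τ k))
      (Y := fun _ x => N x) ?_ ?_
    · let L : (Option ι → ℝ) →L[ℝ] (ι → ℝ) × (Unit → ℝ) :=
        (ContinuousLinearMap.pi fun k => ContinuousLinearMap.proj (some k)).prod
          (ContinuousLinearMap.pi fun _ => ContinuousLinearMap.proj none -
            ∑ j, b j • ContinuousLinearMap.proj (some j))
      have heq : (fun x => (fun k => X x (τ k), fun _ : Unit => N x)) =
          fun x => L fun o => X x (a o) := by
        funext x
        refine Prod.ext rfl ?_
        ext i
        simp [L, N, a]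
      rw [heq]
      exact hlaw.map_fun L
    · intro k _
      have hN2 : MemLp N 2 μ :=
        (hL2 none).sub (memLp_finsetSum _ fun j _ => (hL2 (some j)).const_mul _)
      have hk2 : MemLp (fun x => X x (τ k)) 2 μ := hL2 (some k)
      change cov[fun x => X x (τ k), N; μ] = 0
      rw [covariance_eq_sub hk2 hN2, hX.integral_eval (hτ1 k), zero_mul, sub_zero]
      rw [← hb k]
      exact integral_congr_ae (Eventually.of_forall fun x => mul_comm _ _)
  have hsplit : ∀ x, Φ (fun k => X x (τ k)) * Complex.exp (X x u * Complex.I) =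
      (Φ (fun k => X x (τ k)) *
        Complex.exp ((∑ j, b j * X x (τ j) : ℝ) * Complex.I)) * Complex.exp (N x * Complex.I) := by
    intro x
    rw [mul_assoc, ← Complex.exp_add, ← add_mul, ← Complex.ofReal_add]
    simp [N]
  simp_rw [hsplit]
  rw [hindep.integral_fun_comp_mul_comp
    (f := fun y => Φ y * Complex.exp ((∑ j, b j * y j : ℝ) * Complex.I))
    (g := fun z => Complex.exp (z () * Complex.I)) (by fun_prop) (by fun_prop)
    (by exact (by fun_prop : Measurable _).aestronglyMeasurable)
    (by exact (by fun_prop : Measurable _).aestronglyMeasurable), norm_mul, mul_comm]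
  gcongr
  · let c : Option ι → ℝ := fun o => o.elim 1 fun j => -b j
    have hNlaw : μ.map N = gaussianReal 0 (Real.toNNReal (σ ^ 2 * fbmForm H c a)) := by
      rw [← hX.map_sum c a ha]
      congr 1
      ext x
      simp [N, c, a, Fintype.sum_option, sub_eq_add_neg]
    have hchar := charFun_gaussianReal (μ := 0) (v := Real.toNNReal (σ ^ 2 * fbmForm H c a)) 1
    rw [← hNlaw, charFun_apply_real, integral_map hNm.aemeasurable (by fun_prop)] at hchar
    simp only [Complex.ofReal_one, one_mul] at hchar
    rw [hchar, Complex.norm_exp]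
    have hQ := hκ c a none v rfl hv hlt (fun o => (ha o).1) (by
      rintro (_ | k) hk
      · exact absurd rfl hk
      · exact (hτ k).2)
    have hQ' := mul_le_mul_of_nonneg_left hQ (sq_nonneg σ)
    have hle := hQ'.trans (Real.le_coe_toNNReal _)
    simp only [Complex.ofReal_zero, zero_mul, zero_sub]
    rw [Real.exp_le_exp]
    have hre : (-((Real.toNNReal (σ ^ 2 * fbmForm H c a) : ℂ) * 1 ^ 2 / 2)).re =
        -((Real.toNNReal (σ ^ 2 * fbmForm H c a) : ℝ) / 2) := by
      rw [one_pow, mul_one]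
      norm_cast
    refine hre.le.trans ?_
    have ha0 : a none = u := rfl
    rw [ha0] at hle
    linarith
  · refine (norm_integral_le_integral_norm _).trans (le_of_eq ?_)
    simp_rw [norm_mul, hexp1, mul_one]

end IsScaledFBM

end GaussianConditioning

section Riemann

theorem tendsto_leftRiemannSum {f : ℝ → ℂ} (hf : Continuous f) {s v : ℝ} (hsv : s ≤ v) :
    Tendsto (fun n : ℕ => ((v - s) / n : ℝ) • ∑ k ∈ Finset.range n, f (s + k * ((v - s) / n)))
      atTop (𝓝 (∫ u in s..v, f u)) := by
  have huc : UniformContinuousOn f (Set.Icc s v) :=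
    isCompact_Icc.uniformContinuousOn_of_continuous hf.continuousOn
  rw [Metric.tendsto_atTop]
  intro ε hε
  have hvs : 0 < v - s + 1 := by linarith
  obtain ⟨δ, hδ, hfδ⟩ := Metric.uniformContinuousOn_iff.1 huc (ε / (v - s + 1)) (by positivity)
  obtain ⟨N, hN⟩ := exists_nat_gt ((v - s) / δ)
  refine ⟨N + 1, fun n hn => ?_⟩
  have hn0 : (0 : ℝ) < n := by exact_mod_cast (Nat.succ_pos N).trans_le hn
  have hNn : (N : ℝ) < n := by exact_mod_cast hn
  set h : ℝ := (v - s) / n with hh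
  have hh0 : 0 ≤ h := div_nonneg (by linarith) hn0.le
  have hnh : n * h = v - s := by rw [hh]; field_simp
  have hhδ : h < δ := by
    rw [hh, div_lt_iff₀ hn0]
    rw [div_lt_iff₀ hδ] at hN
    nlinarith
  have hsplit := intervalIntegral.sum_integral_adjacent_intervals (μ := volume) (f := f)
    (a := fun k : ℕ => s + k * h) (n := n) fun k _ => hf.intervalIntegrable _ _
  have hend : s + n * h = v := by rw [hnh]; ring
  simp only [Nat.cast_zero, zero_mul, add_zero, hend] at hsplit
  rw [← hsplit, dist_eq_norm, Finset.smul_sum, ← Finset.sum_sub_distrib]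
  have hterm : ∀ k ∈ Finset.range n,
      ‖h • f (s + k * h) - ∫ u in s + k * h..s + (k + 1 : ℕ) * h, f u‖ ≤
        ε / (v - s + 1) * h := by
    intro k hk
    have hkn : ((k + 1 : ℕ) : ℝ) ≤ n := by exact_mod_cast Finset.mem_range.1 hk
    have hlen : s + (k + 1 : ℕ) * h - (s + k * h) = h := by push_cast; ring
    have hconst : h • f (s + k * h) = ∫ u in s + k * h..s + (k + 1 : ℕ) * h, f (s + k * h) := by
      rw [intervalIntegral.integral_const, hlen]
    rw [hconst, ← intervalIntegral.integral_sub (by simp) (hf.intervalIntegrable _ _)]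
    refine (intervalIntegral.norm_integral_le_of_norm_le_const
      (C := ε / (v - s + 1)) fun u hu => ?_).trans_eq ?_
    · rw [Set.uIoc_of_le (by linarith)] at hu
      have hk0 : 0 ≤ (k : ℝ) * h := by positivity
      have hkv : ((k + 1 : ℕ) : ℝ) * h ≤ n * h := by gcongr
      rw [← dist_eq_norm]
      refine (hfδ _ ⟨by linarith, by linarith [hu.1, hu.2]⟩ _
        ⟨by linarith [hu.1], by linarith [hu.2]⟩ ?_).le
      rw [dist_comm, Real.dist_eq, abs_of_nonneg (by linarith [hu.1])]
      linarith [hu.2]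
    · rw [hlen, abs_of_nonneg hh0]
  refine (norm_sum_le_of_le _ hterm).trans_lt ?_
  rw [Finset.sum_const, Finset.card_range, nsmul_eq_mul, mul_left_comm, hnh, div_mul_eq_mul_div,
    div_lt_iff₀ hvs]
  nlinarith

end Riemann

section PathFunctional

open ComplexConjugate

theorem norm_primitive_le {e : ℝ → ℂ} (he1 : ∀ u, ‖e u‖ = 1) {s v : ℝ} (hsv : s ≤ v) :
    ‖∫ r in s..v, e r‖ ≤ v - s := by
  have h := intervalIntegral.norm_integral_le_of_norm_le_const (a := s) (b := v)
    (C := 1) (f := e) fun u _ => (he1 u).le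
  rwa [one_mul, abs_of_nonneg (by linarith)] at h

/-- The kernel `∂_v (conj Y ^ (p + 1) * Y ^ p)` for a path with `Y = y` and `∂_v Y = z`. -/
def momentKernel (p : ℕ) (y z : ℂ) : ℂ :=
  (p + 1) * conj y ^ p * conj z * y ^ p + conj y ^ (p + 1) * (p * y ^ (p - 1) * z)

theorem continuous_momentKernel (p : ℕ) : Continuous fun q : ℂ × ℂ => momentKernel p q.1 q.2 := by
  unfold momentKernel
  fun_prop

theorem Measurable.momentKernel_comp {α : Type*} [MeasurableSpace α] {f g : α → ℂ}
    (hf : Measurable f) (hg : Measurable g) (p : ℕ) :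
    Measurable fun x => momentKernel p (f x) (g x) := by
  have hf' := Complex.continuous_conj.measurable.comp hf
  have hg' := Complex.continuous_conj.measurable.comp hg
  exact ((((hf'.pow_const p).const_mul _).mul hg').mul (hf.pow_const p)).add
    ((hf'.pow_const _).mul (((hf.pow_const _).const_mul _).mul hg))

theorem Continuous.momentKernel_comp {α : Type*} [TopologicalSpace α] {f g : α → ℂ}
    (hf : Continuous f) (hg : Continuous g) (p : ℕ) :
    Continuous fun x => momentKernel p (f x) (g x) := by
  unfold momentKernel
  fun_prop

theorem norm_momentKernel_le (p : ℕ) (y : ℂ) {z : ℂ} (hz : ‖z‖ = 1) :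
    ‖momentKernel p y z‖ ≤ (2 * p + 1) * ‖y‖ ^ (2 * p) := by
  have hp1 : ‖(p + 1 : ℂ)‖ = p + 1 := by
    have := Complex.norm_natCast (p + 1)
    push_cast at this
    exact this
  refine (norm_add_le _ _).trans (le_of_eq ?_)
  simp only [norm_mul, norm_pow, RCLike.norm_conj, hz, mul_one, hp1, Complex.norm_natCast]
  rcases p with _ | p
  · simp
  · rw [Nat.add_sub_cancel]
    push_cast
    ring

theorem hasDerivAt_conj_primitive {e : ℝ → ℂ} (he : Continuous e) (s v : ℝ) :
    HasDerivAt (fun v => conj (∫ r in s..v, e r)) (conj (e v)) v :=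
  (he.integral_hasStrictDerivAt s v).hasDerivAt.star

theorem integral_momentKernel {e : ℝ → ℂ} (he : Continuous e) (p : ℕ) (s u : ℝ) :
    ∫ v in s..u, momentKernel p (∫ r in s..v, e r) (e v) =
      conj (∫ r in s..u, e r) ^ (p + 1) * (∫ r in s..u, e r) ^ p := by
  have hY : ∀ v, HasDerivAt (fun v => ∫ r in s..v, e r) (e v) v := fun v =>
    (he.integral_hasStrictDerivAt s v).hasDerivAt
  have hcY : Continuous fun v => ∫ r in s..v, e r :=
    continuous_iff_continuousAt.2 fun v => (hY v).continuousAt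
  have hd : ∀ v ∈ Set.uIcc s u, HasDerivAt
      (fun v => conj (∫ r in s..v, e r) ^ (p + 1) * (∫ r in s..v, e r) ^ p)
      (momentKernel p (∫ r in s..v, e r) (e v)) v := by
    intro v _
    have h := ((hasDerivAt_conj_primitive he s v).pow (p + 1)).mul ((hY v).pow p)
    convert! h using 1
    simp [momentKernel]
  rw [intervalIntegral.integral_eq_sub_of_hasDerivAt hd
    (((continuous_momentKernel p).comp (hcY.prodMk he)).intervalIntegrable _ _)]
  simp

theorem norm_primitive_pow {e : ℝ → ℂ} (he : Continuous e) (p : ℕ) (s t : ℝ) :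
    ((‖∫ r in s..t, e r‖ ^ (2 * (p + 1)) : ℝ) : ℂ) =
      ∫ u in s..t, (p + 1) * (conj (conj (∫ r in s..u, e r) ^ (p + 1) *
          (∫ r in s..u, e r) ^ p * e u) +
        conj (∫ r in s..u, e r) ^ (p + 1) * (∫ r in s..u, e r) ^ p * e u) := by
  have hY : ∀ v, HasDerivAt (fun v => ∫ r in s..v, e r) (e v) v := fun v =>
    (he.integral_hasStrictDerivAt s v).hasDerivAt
  have hcY : Continuous fun v => ∫ r in s..v, e r :=
    continuous_iff_continuousAt.2 fun v => (hY v).continuousAt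
  have hd : ∀ u ∈ Set.uIcc s t, HasDerivAt
      (fun v => conj (∫ r in s..v, e r) ^ (p + 1) * (∫ r in s..v, e r) ^ (p + 1))
      ((p + 1) * (conj (conj (∫ r in s..u, e r) ^ (p + 1) *
          (∫ r in s..u, e r) ^ p * e u) +
        conj (∫ r in s..u, e r) ^ (p + 1) * (∫ r in s..u, e r) ^ p * e u)) u := by
    intro u _
    have h := ((hasDerivAt_conj_primitive he s u).pow (p + 1)).mul ((hY u).pow (p + 1))
    convert! h using 1
    simp only [Pi.pow_apply, map_mul, map_pow, Complex.conj_conj, Nat.add_sub_cancel]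
    push_cast
    ring
  rw [intervalIntegral.integral_eq_sub_of_hasDerivAt hd
    (Continuous.intervalIntegrable (by fun_prop) _ _)]
  simp only [intervalIntegral.integral_same, map_zero, ne_eq, Nat.succ_ne_zero,
    not_false_eq_true, zero_pow, mul_zero, sub_zero]
  rw [← mul_pow, Complex.conj_mul', pow_mul]
  push_cast
  rfl

end PathFunctional

section Swap

variable {Ω : Type*} [MeasurableSpace Ω] {μ : Measure Ω}

theorem integral_intervalIntegral_swap [IsFiniteMeasure μ] {f : ℝ → Ω → ℂ} {s t M : ℝ}
    (hc : ∀ x, Continuous fun u => f u x) (hm : ∀ u, Measurable (f u))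
    (hb : ∀ u ∈ Set.uIoc s t, ∀ x, ‖f u x‖ ≤ M) :
    ∫ x, (∫ u in s..t, f u x) ∂μ = ∫ u in s..t, ∫ x, f u x ∂μ := by
  symm
  refine intervalIntegral_integral_swap ?_
  have : IsFiniteMeasure (volume.restrict (Set.uIoc s t)) := by
    unfold Set.uIoc
    infer_instance
  refine Integrable.of_bound
    (measurable_uncurry_of_continuous_of_measurable hc hm).aestronglyMeasurable M ?_
  rw [← Measure.restrict_univ (μ := μ), Measure.prod_restrict]
  filter_upwards [ae_restrict_mem (measurableSet_uIoc.prod .univ)] with q hq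
  exact hb _ hq.1 _

end Swap

section OscillatoryMoments

open ProbabilityTheory ComplexConjugate

variable {Ω : Type*}

/-- The oscillating factor `e^{i (X_u + ω u)}`. -/
def oscExp (X : Ω → ℝ → ℝ) (ω : ℝ) (x : Ω) (u : ℝ) : ℂ :=
  Complex.exp (Complex.I * Complex.ofReal (X x u + ω * u))

theorem norm_oscExp (X : Ω → ℝ → ℝ) (ω : ℝ) (x : Ω) (u : ℝ) : ‖oscExp X ω x u‖ = 1 :=
  Complex.norm_exp_I_mul_ofReal _

theorem oscExp_eq_mul (X : Ω → ℝ → ℝ) (ω : ℝ) (x : Ω) (u : ℝ) :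
    oscExp X ω x u =
      Complex.exp (X x u * Complex.I) * Complex.exp ((ω * u : ℝ) * Complex.I) := by
  rw [oscExp, ← Complex.exp_add]
  push_cast
  ring_nf

namespace IsScaledFBM

variable [MeasurableSpace Ω] {μ : Measure Ω} {H σ : ℝ} {X : Ω → ℝ → ℝ}

theorem continuous_oscExp (hX : IsScaledFBM H σ X μ) (ω : ℝ) (x : Ω) :
    Continuous (oscExp X ω x) := by
  have := hX.continuous_path x
  unfold oscExp
  fun_prop

theorem measurable_oscExp (hX : IsScaledFBM H σ X μ) (ω u : ℝ) :
    Measurable fun x => oscExp X ω x u := by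
  have := hX.measurable_eval u
  unfold oscExp
  fun_prop

theorem measurable_integral_oscExp (hX : IsScaledFBM H σ X μ) (ω : ℝ) (s v : ℝ) :
    Measurable fun x => ∫ r in s..v, oscExp X ω x r := by
  have hm := hX.measurable_oscExp ω
  have key : ∀ {a b : ℝ}, a ≤ b → Measurable fun x => ∫ r in a..b, oscExp X ω x r := by
    intro a b hab
    refine measurable_of_tendsto_metrizable (f := fun (n : ℕ) x => ((b - a) / n : ℝ) •
      ∑ k ∈ Finset.range n, oscExp X ω x (a + k * ((b - a) / n))) (fun n => by fun_prop) ?_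
    exact tendsto_pi_nhds.2 fun x => tendsto_leftRiemannSum (hX.continuous_oscExp ω x) hab
  rcases le_total s v with h | h
  · exact key h
  · simp_rw [intervalIntegral.integral_symm v s]
    exact (key h).neg

theorem continuous_integral_oscExp (hX : IsScaledFBM H σ X μ) (ω : ℝ) (s : ℝ) (x : Ω) :
    Continuous fun v => ∫ r in s..v, oscExp X ω x r :=
  continuous_iff_continuousAt.2 fun v =>
    ((hX.continuous_oscExp ω x).integral_hasStrictDerivAt s v).hasDerivAt.continuousAt

theorem norm_integral_functional_mul_oscExp_le [IsProbabilityMeasure μ]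
    (hX : IsScaledFBM H σ X μ) (hH : 0 < H) {κ : ℝ}
    (hκ : ∀ {ι : Type} [Fintype ι] (c a : ι → ℝ) (k₀ : ι) (v : ℝ), c k₀ = 1 →
      0 ≤ v → v < a k₀ → (∀ k, 0 ≤ a k) → (∀ k, k ≠ k₀ → a k ≤ v) →
      κ * (a k₀ - v) ^ (2 * H) ≤ fbmForm H c a)
    (ω : ℝ) {s u v : ℝ} (hs : 0 ≤ s) (hsv : s ≤ v) (hvu : v ≤ u) (hu : u ≤ 1)
    {F : ℂ → ℂ → ℂ} (hF : Continuous fun q : ℂ × ℂ => F q.1 q.2) :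
    ‖∫ x, F (∫ r in s..v, oscExp X ω x r) (oscExp X ω x v) * oscExp X ω x u ∂μ‖ ≤
      Real.exp (-(σ ^ 2 * κ / 2 * (u - v) ^ (2 * H))) *
        ∫ x, ‖F (∫ r in s..v, oscExp X ω x r) (oscExp X ω x v)‖ ∂μ := by
  have hm := hX.measurable_oscExp ω
  let S : ℕ → Ω → ℂ := fun n x =>
    ((v - s) / n : ℝ) • ∑ k ∈ Finset.range n, oscExp X ω x (s + k * ((v - s) / n))
  have hSm : ∀ n, Measurable (S n) := fun n => by fun_prop
  have hSlim : ∀ x, Tendsto (fun n => S n x) atTop (𝓝 (∫ r in s..v, oscExp X ω x r)) :=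
    fun x => tendsto_leftRiemannSum (hX.continuous_oscExp ω x) hsv
  have hSb : ∀ n x, ‖S n x‖ ≤ 1 := by
    intro n x
    rcases Nat.eq_zero_or_pos n with rfl | hn
    · simp [S]
    have hn0 : (0 : ℝ) < n := by exact_mod_cast hn
    have hq : 0 ≤ (v - s) / n := div_nonneg (by linarith) hn0.le
    calc ‖S n x‖ ≤ (v - s) / n * ∑ k ∈ Finset.range n, 1 := by
          rw [norm_smul, Real.norm_of_nonneg hq]
          gcongr
          exact norm_sum_le_of_le _ fun k _ => (norm_oscExp X ω x _).le
      _ = v - s := by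
          rw [Finset.sum_const, Finset.card_range, nsmul_eq_mul, mul_one]
          field_simp
      _ ≤ 1 := by linarith
  obtain ⟨M, hM⟩ := ((isCompact_closedBall (0 : ℂ) 1).prod
    (isCompact_closedBall (0 : ℂ) 1)).exists_bound_of_continuousOn hF.continuousOn
  have hMb : ∀ n x, ‖F (S n x) (oscExp X ω x v)‖ ≤ M := fun n x =>
    hM (S n x, oscExp X ω x v) ⟨by simpa using hSb n x, by simp [norm_oscExp]⟩
  have hFm : ∀ n, Measurable fun x => F (S n x) (oscExp X ω x v) := fun n =>
    hF.measurable.comp ((hSm n).prodMk (hm v))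
  have hFlim : ∀ x, Tendsto (fun n => F (S n x) (oscExp X ω x v)) atTop
      (𝓝 (F (∫ r in s..v, oscExp X ω x r) (oscExp X ω x v))) := fun x =>
    (hF.tendsto (∫ r in s..v, oscExp X ω x r, oscExp X ω x v)).comp
      ((hSlim x).prodMk_nhds tendsto_const_nhds)
  have hlim1 := tendsto_integral_of_dominated_convergence (μ := μ) (fun _ => M)
    (F := fun n x => F (S n x) (oscExp X ω x v) * oscExp X ω x u)
    (fun n => ((hFm n).mul (hm u)).aestronglyMeasurable) (integrable_const _)
    (fun n => Eventually.of_forall fun x => by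
      rw [norm_mul, norm_oscExp, mul_one]
      exact hMb n x)
    (Eventually.of_forall fun x => (hFlim x).mul_const _)
  have hlim2 := tendsto_integral_of_dominated_convergence (μ := μ) (fun _ => M)
    (F := fun n x => ‖F (S n x) (oscExp X ω x v)‖)
    (fun n => (hFm n).norm.aestronglyMeasurable) (integrable_const _)
    (fun n => Eventually.of_forall fun x => by
      rw [norm_norm]
      exact hMb n x)
    (Eventually.of_forall fun x => (hFlim x).norm)
  refine le_of_tendsto_of_tendsto' hlim1.norm (hlim2.const_mul _) fun n => ?_
  let τ : Option (Fin n) → ℝ := fun o => o.elim v fun k => s + k * ((v - s) / n)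
  have hτ : ∀ o, τ o ∈ Set.Icc 0 v := by
    rintro (_ | k)
    · exact ⟨hs.trans hsv, le_rfl⟩
    · have hn0 : (0 : ℝ) < n := by exact_mod_cast k.pos
      have hkn : (k : ℝ) ≤ n := by exact_mod_cast k.is_lt.le
      have hq : 0 ≤ (v - s) / n := div_nonneg (by linarith) hn0.le
      have h1 : (k : ℝ) * ((v - s) / n) ≤ n * ((v - s) / n) := by gcongr
      have h2 : (n : ℝ) * ((v - s) / n) = v - s := by field_simp
      have h3 : 0 ≤ (k : ℝ) * ((v - s) / n) := by positivity
      exact ⟨by change 0 ≤ s + _; linarith, by change s + _ ≤ v; linarith⟩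
  let E : Option (Fin n) → (Option (Fin n) → ℝ) → ℂ := fun o y =>
    Complex.exp (Complex.I * Complex.ofReal (y o + ω * τ o))
  have hEm : ∀ o, Measurable (E o) := fun o => by fun_prop
  let G : (Option (Fin n) → ℝ) → ℂ := fun y =>
    F (((v - s) / n : ℝ) • ∑ k : Fin n, E (some k) y) (E none y)
  have hG : Measurable G := hF.measurable.comp (Measurable.prodMk (by fun_prop) (hEm none))
  have hGS : ∀ x, G (fun o => X x (τ o)) = F (S n x) (oscExp X ω x v) := by
    intro x
    have : S n x = ((v - s) / n : ℝ) • ∑ k : Fin n, E (some k) fun o => X x (τ o) := by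
      simp only [S]
      rw [← Fin.sum_univ_eq_sum_range (fun k => oscExp X ω x (s + k * ((v - s) / n)))]
      rfl
    rw [this]
    rfl
  have h := hX.norm_integral_mul_exp_le hH hκ (hs.trans hsv) hvu hu τ hτ hG
  simp_rw [hGS] at h
  refine le_trans (le_of_eq ?_) h
  simp_rw [oscExp_eq_mul X ω _ u, ← mul_assoc]
  rw [integral_mul_const, norm_mul, Complex.norm_exp_ofReal_mul_I, mul_one]

theorem integral_norm_pow_le [IsProbabilityMeasure μ]
    (hX : IsScaledFBM H σ X μ) (hH : 0 < H) {κ : ℝ}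
    (hκ : ∀ {ι : Type} [Fintype ι] (c a : ι → ℝ) (k₀ : ι) (v : ℝ), c k₀ = 1 →
      0 ≤ v → v < a k₀ → (∀ k, 0 ≤ a k) → (∀ k, k ≠ k₀ → a k ≤ v) →
      κ * (a k₀ - v) ^ (2 * H) ≤ fbmForm H c a)
    {A : ℝ} (hA0 : 0 ≤ A)
    (hA : ∀ r, 0 ≤ r → ∫ q in (0 : ℝ)..r, Real.exp (-(σ ^ 2 * κ / 2 * q ^ (2 * H))) ≤ A)
    (ω : ℝ) {s : ℝ} (hs : 0 ≤ s) (p : ℕ) :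
    ∀ {t : ℝ}, s ≤ t → t ≤ 1 → ∫ x, ‖∫ r in s..t, oscExp X ω x r‖ ^ (2 * p) ∂μ ≤
      ((2 * p).factorial : ℝ) / (p.factorial : ℝ) * A ^ p * (t - s) ^ p := by
  have hem := hX.measurable_oscExp ω
  have hec := hX.continuous_oscExp ω
  have hYm := hX.measurable_integral_oscExp ω s
  have hYc := hX.continuous_integral_oscExp ω s
  have hYb : ∀ {v}, s ≤ v → v ≤ 1 → ∀ x, ‖∫ r in s..v, oscExp X ω x r‖ ≤ 1 := fun h h' x =>
    (norm_primitive_le (norm_oscExp X ω x) h).trans (by linarith)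
  induction p with
  | zero =>
    intro t _ _
    simp
  | succ p ih =>
    intro t hst ht
    set c : ℝ := ((2 * p).factorial : ℝ) / (p.factorial : ℝ) * A ^ p with hc
    have hc0 : 0 ≤ c := by positivity
    let G : ℝ → Ω → ℂ := fun u x => conj (∫ r in s..u, oscExp X ω x r) ^ (p + 1) *
      (∫ r in s..u, oscExp X ω x r) ^ p * oscExp X ω x u
    have hGm : ∀ u, Measurable (G u) := fun u =>
      (((Complex.continuous_conj.measurable.comp (hYm u)).pow_const _).mul
        ((hYm u).pow_const _)).mul (hem u)
    have hGb : ∀ {u}, s ≤ u → u ≤ 1 → ∀ x, ‖G u x‖ ≤ 1 := by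
      intro u h h' x
      simp only [G, norm_mul, norm_pow, RCLike.norm_conj, norm_oscExp, mul_one]
      exact mul_le_one₀ (pow_le_one₀ (norm_nonneg _) (hYb h h' x)) (by positivity)
        (pow_le_one₀ (norm_nonneg _) (hYb h h' x))
    have hGi : ∀ {u}, s ≤ u → u ≤ 1 → Integrable (G u) μ := fun h h' =>
      Integrable.of_bound (hGm _).aestronglyMeasurable 1 (Eventually.of_forall (hGb h h'))
    have hGle : ∀ {u}, s ≤ u → u ≤ 1 →
        ‖∫ x, G u x ∂μ‖ ≤ A * ((2 * p + 1) * (c * (u - s) ^ p)) := by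
      intro u hsu hu
      have hrep : ∀ x, G u x = ∫ v in s..u, momentKernel p (∫ r in s..v, oscExp X ω x r)
          (oscExp X ω x v) * oscExp X ω x u := by
        intro x
        rw [intervalIntegral.integral_mul_const, integral_momentKernel (hec x)]
      simp_rw [hrep]
      have hmK : ∀ v, Measurable fun x => momentKernel p (∫ r in s..v, oscExp X ω x r)
          (oscExp X ω x v) := fun v =>
        (hYm v).momentKernel_comp (hem v) p
      have hcK : ∀ x, Continuous fun v => momentKernel p (∫ r in s..v, oscExp X ω x r)
          (oscExp X ω x v) * oscExp X ω x u := fun x =>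
        ((hYc x).momentKernel_comp (hec x) p).mul continuous_const
      rw [integral_intervalIntegral_swap (M := 2 * p + 1) hcK
        (fun v => (hmK v).mul (hem u)) ?_]
      · have hbound : ∀ v ∈ Set.Ioc s u, ‖∫ x, momentKernel p (∫ r in s..v, oscExp X ω x r)
            (oscExp X ω x v) * oscExp X ω x u ∂μ‖ ≤
            Real.exp (-(σ ^ 2 * κ / 2 * (u - v) ^ (2 * H))) *
              ((2 * p + 1) * (c * (u - s) ^ p)) := by
          intro v hv
          refine (hX.norm_integral_functional_mul_oscExp_le hH hκ ω hs hv.1.le hv.2 hu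
            (continuous_momentKernel p)).trans ?_
          gcongr
          calc ∫ x, ‖momentKernel p (∫ r in s..v, oscExp X ω x r) (oscExp X ω x v)‖ ∂μ
              ≤ ∫ x, (2 * p + 1) * ‖∫ r in s..v, oscExp X ω x r‖ ^ (2 * p) ∂μ := by
                refine integral_mono_of_nonneg (Eventually.of_forall fun _ => norm_nonneg _)
                  (Integrable.const_mul ?_ _) (Eventually.of_forall fun x =>
                    norm_momentKernel_le p _ (norm_oscExp X ω x v))
                refine Integrable.of_bound ((hYm v).norm.pow_const _).aestronglyMeasurable 1
                  (Eventually.of_forall fun x => ?_)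
                rw [norm_pow, norm_norm]
                exact pow_le_one₀ (norm_nonneg _) (hYb hv.1.le (hv.2.trans hu) x)
            _ ≤ (2 * p + 1) * (c * (v - s) ^ p) := by
                rw [integral_const_mul]
                gcongr
                exact ih hv.1.le (hv.2.trans hu)
            _ ≤ (2 * p + 1) * (c * (u - s) ^ p) := by
                have := hv.1
                have := hv.2
                gcongr
        have hcont : Continuous fun q : ℝ => Real.exp (-(σ ^ 2 * κ / 2 * q ^ (2 * H))) := by
          have : Continuous fun q : ℝ => q ^ (2 * H) :=
            Real.continuous_rpow_const (by positivity)
          fun_prop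
        refine (intervalIntegral.norm_integral_le_of_norm_le hsu
          (Eventually.of_forall hbound) (Continuous.intervalIntegrable ?_ _ _)).trans ?_
        · exact (hcont.comp (continuous_const.sub continuous_id)).mul_const _
        · rw [intervalIntegral.integral_mul_const, intervalIntegral.integral_comp_sub_left
            (fun q : ℝ => Real.exp (-(σ ^ 2 * κ / 2 * q ^ (2 * H)))), sub_self]
          have hus : 0 ≤ u - s := by linarith
          gcongr
          exact hA _ hus
      · intro v hv x
        rw [Set.uIoc_of_le hsu] at hv
        rw [norm_mul, norm_oscExp, mul_one]
        refine (norm_momentKernel_le p _ (norm_oscExp X ω x v)).trans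
          (mul_le_of_le_one_right (by positivity)
            (pow_le_one₀ (norm_nonneg _) (hYb hv.1.le (hv.2.trans hu) x)))
    have hexpand : ((∫ x, ‖∫ r in s..t, oscExp X ω x r‖ ^ (2 * (p + 1)) ∂μ : ℝ) : ℂ) =
        ∫ u in s..t, ∫ x, (p + 1) * (conj (G u x) + G u x) ∂μ := by
      rw [← integral_complex_ofReal]
      simp_rw [norm_primitive_pow (hec _)]
      refine integral_intervalIntegral_swap (M := (p + 1) * 2) (fun x => ?_) (fun u => ?_) ?_
      · have := hYc x
        have := hec x
        fun_prop
      · exact ((Complex.continuous_conj.measurable.comp (hGm u)).add (hGm u)).const_mul _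
      · intro u hu x
        rw [Set.uIoc_of_le hst] at hu
        have h1 := hGb hu.1.le (hu.2.trans ht) x
        have hp1 : ‖(p + 1 : ℂ)‖ = p + 1 := by exact_mod_cast Complex.norm_natCast (p + 1)
        rw [norm_mul, hp1]
        gcongr
        refine (norm_add_le _ _).trans ?_
        rw [RCLike.norm_conj]
        change ‖G u x‖ + ‖G u x‖ ≤ 2
        linarith
    have hfinal : ∫ x, ‖∫ r in s..t, oscExp X ω x r‖ ^ (2 * (p + 1)) ∂μ ≤
        ∫ u in s..t, (p + 1) * 2 * (A * ((2 * p + 1) * (c * (u - s) ^ p))) := by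
      refine (le_abs_self _).trans ?_
      rw [← Real.norm_eq_abs, ← Complex.norm_real, hexpand]
      refine intervalIntegral.norm_integral_le_of_norm_le hst
        (Eventually.of_forall fun u hu => ?_) (Continuous.intervalIntegrable (by fun_prop) _ _)
      have hGu := hGi hu.1.le (hu.2.trans ht)
      have hGl := hGle hu.1.le (hu.2.trans ht)
      have hp1 : ‖(p + 1 : ℂ)‖ = p + 1 := by exact_mod_cast Complex.norm_natCast (p + 1)
      have hconj : Integrable (fun x => conj (G u x)) μ :=
        hGu.mono (Complex.continuous_conj.measurable.comp (hGm u)).aestronglyMeasurable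
          (Eventually.of_forall fun x => (RCLike.norm_conj _).le)
      rw [integral_const_mul, integral_add hconj hGu, integral_conj, norm_mul, hp1, mul_assoc]
      gcongr
      refine (norm_add_le _ _).trans ?_
      rw [RCLike.norm_conj]
      linarith
    refine hfinal.trans (le_of_eq ?_)
    simp_rw [intervalIntegral.integral_const_mul]
    rw [intervalIntegral.integral_comp_sub_right (fun q => q ^ p), sub_self, integral_pow, hc,
      show 2 * (p + 1) = 2 * p + 1 + 1 by ring, Nat.factorial_succ (2 * p + 1),
      Nat.factorial_succ (2 * p), Nat.factorial_succ p, zero_pow (Nat.succ_ne_zero p)]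
    push_cast
    field_simp
    ring

end IsScaledFBM

end OscillatoryMoments

theorem IsFBM.isScaledFBM_inner {Ω : Type*} [MeasureSpace Ω] {d : ℕ} {H : ℝ}
    {W : Ω → ℝ → Euc d} (hW : IsFBM d H W) (ξ : Euc d) :
    IsScaledFBM H ‖ξ‖ (fun x t => inner ℝ ξ (W x (Set.projIcc 0 1 zero_le_one t)))
      (volume : Measure Ω) where
  continuous_path x := by
    have h : Continuous fun t => W x (Set.projIcc (0 : ℝ) 1 zero_le_one t) :=
      (continuousOn_iff_continuous_domRestrict.1 (hW.1 x)).comp continuous_projIcc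
    exact continuous_const.inner h
  measurable_eval t := by
    have h := hW.2.1 (Set.projIcc (0 : ℝ) 1 zero_le_one t)
    fun_prop
  map_sum {ι} _ c a ha := by
    let e := (Fintype.equivFin (ι × Fin d)).symm
    have h := hW.2.2.2 _ (fun m => c (e m).1 * ξ (e m).2) (fun m => a (e m).1)
      (fun m => (e m).2) fun m => ha _
    have hvar : ∑ m, ∑ n, c (e m).1 * ξ (e m).2 * (c (e n).1 * ξ (e n).2) *
        (if (e m).2 = (e n).2 then fbmCov H (a (e m).1) (a (e n).1) else 0) =
        ‖ξ‖ ^ 2 * fbmForm H c a := by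
      rw [Equiv.sum_comp e fun q => ∑ n, c q.1 * ξ q.2 * (c (e n).1 * ξ (e n).2) *
        (if q.2 = (e n).2 then fbmCov H (a q.1) (a (e n).1) else 0)]
      simp_rw [fun q : ι × Fin d => Equiv.sum_comp e fun r => c q.1 * ξ q.2 * (c r.1 * ξ r.2) *
        (if q.2 = r.2 then fbmCov H (a q.1) (a r.1) else 0), Fintype.sum_prod_type]
      simp only [mul_ite, mul_zero, Finset.sum_ite_eq, Finset.mem_univ, if_true]
      rw [EuclideanSpace.norm_sq_eq, Finset.sum_mul, Finset.sum_comm]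
      refine Finset.sum_congr rfl fun i _ => ?_
      rw [fbmForm, Finset.mul_sum]
      refine Finset.sum_congr rfl fun k _ => ?_
      rw [Finset.mul_sum]
      refine Finset.sum_congr rfl fun l _ => ?_
      rw [Real.norm_eq_abs, sq_abs]
      ring
    rw [hvar] at h
    rw [← h]
    refine congrArg (Measure.map · volume) (funext fun x => ?_)
    rw [Equiv.sum_comp e fun q => c q.1 * ξ q.2 * W x (a q.1) q.2, Fintype.sum_prod_type]
    refine Finset.sum_congr rfl fun k _ => ?_
    rw [Set.projIcc_of_mem _ (ha k), PiLp.inner_apply, Finset.mul_sum]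
    refine Finset.sum_congr rfl fun i _ => ?_
    simp only [RCLike.inner_apply, conj_trivial]
    ring

theorem integral_exp_neg_mul_rpow_le {β q : ℝ} (hβ : 0 < β) (hq : 0 < q) {r : ℝ} (hr : 0 ≤ r) :
    ∫ y in (0 : ℝ)..r, Real.exp (-(β * y ^ q)) ≤ β ^ (-1 / q) * Real.Gamma (1 / q + 1) := by
  rw [← integral_exp_neg_mul_rpow hq hβ, intervalIntegral.integral_of_le hr]
  simp_rw [← neg_mul]
  refine setIntegral_mono_set ?_ (Eventually.of_forall fun y => (Real.exp_pos _).le)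
    (Set.Ioc_subset_Ioi_self.eventuallyLE)
  simpa using integrableOn_rpow_mul_exp_neg_mul_rpow (s := 0) (by norm_num) hq hβ

/-- Moment bound for the oscillatory integral of the fBm: there is
`C_H` such that `E[|∫_s^t e^{i⟨ξ,W_u⟩+iωu} du|^{2p}] ≤ ((2p)!/p!) C_H^p ((t−s)|ξ|^{−1/H})^p`. -/
theorem statement18 (H : ℝ) (hH : 0 < H) (hH1 : H < 1) :
    ∃ C : ℝ, 0 < C ∧ ∀ (d : ℕ), 0 < d →
      ∀ (Ω : Type) [MeasureSpace Ω], IsProbabilityMeasure (volume : Measure Ω) →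
      ∀ W : Ω → ℝ → Euc d, IsFBM d H W →
      ∀ p : ℕ, 1 ≤ p → ∀ s t : ℝ, 0 ≤ s → s < t → t ≤ 1 →
      ∀ (ω : ℝ) (ξ : Euc d), ξ ≠ 0 →
      (∫⁻ x : Ω, ENNReal.ofReal (‖Yint (W x) s t ω ξ‖ ^ (2 * p))) ≤
        ENNReal.ofReal (((2 * p).factorial : ℝ) / (p.factorial : ℝ) * C ^ p *
          ((t - s) * ‖ξ‖ ^ (-(1 / H))) ^ p) := by
  obtain ⟨κ, hκ0, hκ⟩ := exists_fbmForm_lower_bound hH hH1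
  have hq : 0 < 2 * H := by positivity
  have hΓ : 0 < Real.Gamma (1 / (2 * H) + 1) := Real.Gamma_pos_of_pos (by positivity)
  refine ⟨(κ / 2) ^ (-1 / (2 * H)) * Real.Gamma (1 / (2 * H) + 1), by positivity, ?_⟩
  intro d _ Ω _ hprob W hW p _ s t hs hst ht ω ξ hξ
  have hξ0 : 0 < ‖ξ‖ := norm_pos_iff.2 hξ
  have hX := hW.isScaledFBM_inner ξ
  set X : Ω → ℝ → ℝ := fun x t => inner ℝ ξ (W x (Set.projIcc 0 1 zero_le_one t)) with hXdef
  have hY : ∀ x, Yint (W x) s t ω ξ = ∫ r in s..t, oscExp X ω x r := by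
    intro x
    refine intervalIntegral.integral_congr fun u hu => ?_
    rw [Set.uIcc_of_le hst.le] at hu
    simp only [oscExp, hXdef]
    rw [Set.projIcc_of_mem zero_le_one ⟨hs.trans hu.1, hu.2.trans ht⟩]
  have hscale : (‖ξ‖ ^ 2 * κ / 2) ^ (-1 / (2 * H)) =
      (κ / 2) ^ (-1 / (2 * H)) * ‖ξ‖ ^ (-(1 / H)) := by
    rw [mul_div_assoc, Real.mul_rpow (by positivity) (by positivity), mul_comm,
      ← Real.rpow_natCast, ← Real.rpow_mul hξ0.le]
    congr 2
    push_cast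
    field_simp
  have hmoment := hX.integral_norm_pow_le hH hκ
    (A := (‖ξ‖ ^ 2 * κ / 2) ^ (-1 / (2 * H)) * Real.Gamma (1 / (2 * H) + 1)) (by positivity)
    (fun r hr => integral_exp_neg_mul_rpow_le (by positivity) hq hr) ω hs p hst.le ht
  simp_rw [hY]
  rw [← ofReal_integral_eq_lintegral_ofReal _ (Eventually.of_forall fun _ => by positivity)]
  · refine ENNReal.ofReal_le_ofReal (hmoment.trans (le_of_eq ?_))
    rw [hscale, mul_pow, mul_pow, mul_pow, mul_pow]
    ring
  · refine Integrable.of_bound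
      ((hX.measurable_integral_oscExp ω s t).norm.pow_const _).aestronglyMeasurable 1
      (Eventually.of_forall fun x => ?_)
    rw [norm_pow, norm_norm]
    exact pow_le_one₀ (norm_nonneg _)
      ((norm_primitive_le (norm_oscExp X ω x) hst.le).trans (by linarith))
end
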